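/- Main theorem (Friedgut's conjecture, quantitative form): there is an absolute constant C > 0 such that for all ε ∈ (0,1), all even n, and all nonempty proper subfamilies 𝒜 ⊊ binom([n], n/2), if n ≥ (C/ε²)(log(1/ε) + log(1/(μ(𝒜)(1-μ(𝒜))))), then for r = ⌈ε√n⌉, μ(∂^{+r}(𝒜) ∩ ∂^{+r}(𝒜^c)) ≥ c·(ε²/log(1/(ε μ(𝒜)(1-μ(𝒜)))))·μ(𝒜)(1-μ(𝒜)) for some absolute constant c > 0. -/

import Mathlib

open Finset Real

section Johnson

variable {α : Type*} [Fintype α] [DecidableEq α]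

/-- Double counting of the pairs `T ⊂ S` in consecutive layers. -/
lemma sum_erase_eq_sum_insert (m : ℕ) (F : Finset α → Finset α → ℝ) :
    ∑ S ∈ powersetCard (m + 1) (univ : Finset α), ∑ a ∈ S, F S (S.erase a) =
      ∑ T ∈ powersetCard m (univ : Finset α), ∑ a ∈ Tᶜ, F (insert a T) T := by
  rw [sum_sigma', sum_sigma']
  refine sum_nbij' (fun x => ⟨x.1.erase x.2, x.2⟩) (fun x => ⟨insert x.2 x.1, x.2⟩) ?_ ?_ ?_ ?_ ?_
  · rintro ⟨S, a⟩ h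
    simp only [mem_sigma, mem_powersetCard, subset_univ, true_and, mem_compl] at h ⊢
    exact ⟨by rw [card_erase_of_mem h.2, h.1]; rfl, notMem_erase a S⟩
  · rintro ⟨T, a⟩ h
    simp only [mem_sigma, mem_powersetCard, subset_univ, true_and, mem_compl] at h ⊢
    exact ⟨by rw [card_insert_of_notMem h.2, h.1], mem_insert_self a T⟩
  · rintro ⟨S, a⟩ h
    simp only [mem_sigma] at h
    simp [insert_erase h.2]
  · rintro ⟨T, a⟩ h
    simp only [mem_sigma, mem_compl] at h
    simp [erase_insert h.2]
  · rintro ⟨S, a⟩ h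
    simp only [mem_sigma] at h
    simp [insert_erase h.2]

/-- The lowering operator of the Boolean lattice: sum over all sets covering `T`. -/
def lowerSum (f : Finset α → ℝ) (T : Finset α) : ℝ := ∑ a ∈ Tᶜ, f (insert a T)

/-- The raising operator of the Boolean lattice: sum over all sets covered by `S`. -/
def raiseSum (f : Finset α → ℝ) (S : Finset α) : ℝ := ∑ a ∈ S, f (S.erase a)

lemma sum_mul_raiseSum (m : ℕ) (f g : Finset α → ℝ) :
    ∑ S ∈ powersetCard (m + 1) (univ : Finset α), f S * raiseSum g S =
      ∑ T ∈ powersetCard m (univ : Finset α), lowerSum f T * g T := by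
  simp only [raiseSum, lowerSum, mul_sum, sum_mul]
  exact sum_erase_eq_sum_insert m fun S T => f S * g T

lemma sum_lowerSum (m : ℕ) (f : Finset α → ℝ) :
    ∑ T ∈ powersetCard m (univ : Finset α), lowerSum f T =
      (m + 1) * ∑ S ∈ powersetCard (m + 1) (univ : Finset α), f S := by
  have h := sum_mul_raiseSum m f 1
  simp only [Pi.one_apply, mul_one] at h
  rw [← h, mul_sum]
  refine sum_congr rfl fun S hS => ?_
  simp [raiseSum, (mem_powersetCard.1 hS).2, mul_comm]

lemma lowerSum_raiseSum (f : Finset α → ℝ) (S : Finset α) :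
    lowerSum (raiseSum f) S =
      raiseSum (lowerSum f) S + ((Fintype.card α : ℝ) - 2 * #S) * f S := by
  have h1 : lowerSum (raiseSum f) S =
      #Sᶜ * f S + ∑ b ∈ Sᶜ, ∑ a ∈ S, f (insert b (S.erase a)) := by
    rw [← nsmul_eq_mul, ← sum_const, ← sum_add_distrib]
    refine sum_congr rfl fun b hb => ?_
    rw [mem_compl] at hb
    rw [raiseSum, sum_insert hb, erase_insert hb]
    congr 1
    refine sum_congr rfl fun a ha => ?_
    rw [erase_insert_of_ne (by rintro rfl; exact hb ha)]
  have h2 : raiseSum (lowerSum f) S =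
      #S * f S + ∑ b ∈ Sᶜ, ∑ a ∈ S, f (insert b (S.erase a)) := by
    rw [sum_comm, ← nsmul_eq_mul, ← sum_const, ← sum_add_distrib]
    refine sum_congr rfl fun a ha => ?_
    rw [lowerSum, compl_erase, sum_insert (by simpa using ha), insert_erase ha]
  rw [h1, h2, card_compl, Nat.cast_sub (card_le_univ S)]
  ring

/-- The spectral bound for the lowering operator on functions of mean zero. -/
lemma sum_sq_lowerSum_le (m : ℕ) (hm : m + 1 ≤ Fintype.card α) (f : Finset α → ℝ)
    (hf : ∑ S ∈ powersetCard (m + 1) (univ : Finset α), f S = 0) :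
    ∑ T ∈ powersetCard m (univ : Finset α), lowerSum f T ^ 2 ≤
      m * ((Fintype.card α : ℝ) - m - 1) *
        ∑ S ∈ powersetCard (m + 1) (univ : Finset α), f S ^ 2 := by
  induction m generalizing f with
  | zero =>
    have h := sum_lowerSum 0 f
    rw [hf] at h
    simp only [powersetCard_zero, sum_singleton, mul_zero] at h
    simp [h]
  | succ m ih =>
    have hg := sum_lowerSum (m + 1) f
    rw [hf, mul_zero] at hg
    have hDg := ih (by omega) (lowerSum f) hg
    have hX : ∑ T ∈ powersetCard (m + 1) (univ : Finset α), lowerSum f T ^ 2 =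
        ∑ S ∈ powersetCard (m + 1 + 1) (univ : Finset α), f S * raiseSum (lowerSum f) S := by
      simp only [sum_mul_raiseSum, sq]
    have hU : ∑ S ∈ powersetCard (m + 1 + 1) (univ : Finset α), raiseSum (lowerSum f) S ^ 2 =
        ∑ T ∈ powersetCard m (univ : Finset α), lowerSum (lowerSum f) T ^ 2 +
        ((Fintype.card α : ℝ) - 2 * (m + 1)) *
          ∑ T ∈ powersetCard (m + 1) (univ : Finset α), lowerSum f T ^ 2 := by
      simp only [sq]
      rw [sum_mul_raiseSum, ← sum_mul_raiseSum m (lowerSum f), mul_sum, ← sum_add_distrib]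
      refine sum_congr rfl fun T hT => ?_
      rw [lowerSum_raiseSum, (mem_powersetCard.1 hT).2]
      push_cast
      ring
    have hCS := sum_mul_sq_le_sq_mul_sq (powersetCard (m + 1 + 1) (univ : Finset α)) f
      (raiseSum (lowerSum f))
    rw [← hX, hU] at hCS
    have hF : 0 ≤ ∑ S ∈ powersetCard (m + 1 + 1) (univ : Finset α), f S ^ 2 :=
      sum_nonneg fun _ _ => sq_nonneg _
    have hG : 0 ≤ ∑ T ∈ powersetCard (m + 1) (univ : Finset α), lowerSum f T ^ 2 :=
      sum_nonneg fun _ _ => sq_nonneg _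
    set X := ∑ T ∈ powersetCard (m + 1) (univ : Finset α), lowerSum f T ^ 2
    set Y := ∑ S ∈ powersetCard (m + 1 + 1) (univ : Finset α), f S ^ 2
    have hn : ((m : ℝ) + 1 + 1) ≤ Fintype.card α := by exact_mod_cast hm
    have hK : 0 ≤ ((m : ℝ) + 1) * ((Fintype.card α : ℝ) - (m + 1) - 1) :=
      mul_nonneg (by positivity) (by linarith)
    have key : X * X ≤ (((m : ℝ) + 1) * ((Fintype.card α : ℝ) - (m + 1) - 1) * Y) * X := by
      calc X * X = X ^ 2 := (sq X).symm
        _ ≤ _ := hCS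
        _ ≤ Y * (m * ((Fintype.card α : ℝ) - m - 1) * X +
              ((Fintype.card α : ℝ) - 2 * (m + 1)) * X) := by gcongr
        _ = _ := by ring
    push_cast
    rcases hG.eq_or_lt with h0 | h0
    · rw [← h0]; exact mul_nonneg hK hF
    · exact le_of_mul_le_mul_right key h0

/-- The Poincaré inequality for the Johnson graph, with the Dirichlet form written as a sum
over the sets one layer below. -/
lemma johnson_poincare (m : ℕ) (hm : m + 1 ≤ Fintype.card α) (f : Finset α → ℝ)
    (hf : ∑ S ∈ powersetCard (m + 1) (univ : Finset α), f S = 0) :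
    2 * (Fintype.card α : ℝ) * ∑ S ∈ powersetCard (m + 1) (univ : Finset α), f S ^ 2 ≤
      ∑ T ∈ powersetCard m (univ : Finset α),
        ∑ a ∈ Tᶜ, ∑ b ∈ Tᶜ, (f (insert a T) - f (insert b T)) ^ 2 := by
  have h1 := sum_sq_lowerSum_le m hm f hf
  have h2 := sum_lowerSum m fun S => f S ^ 2
  have h3 : ∑ T ∈ powersetCard m (univ : Finset α),
        ∑ a ∈ Tᶜ, ∑ b ∈ Tᶜ, (f (insert a T) - f (insert b T)) ^ 2 =
      2 * ((Fintype.card α : ℝ) - m) *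
        ∑ T ∈ powersetCard m (univ : Finset α), lowerSum (fun S => f S ^ 2) T -
      2 * ∑ T ∈ powersetCard m (univ : Finset α), lowerSum f T ^ 2 := by
    rw [mul_sum, mul_sum, ← sum_sub_distrib]
    refine sum_congr rfl fun T hT => ?_
    have hc : ((#Tᶜ : ℕ) : ℝ) = (Fintype.card α : ℝ) - m := by
      rw [card_compl, Nat.cast_sub (card_le_univ T), (mem_powersetCard.1 hT).2]
    simp only [sub_sq, sum_add_distrib, sum_sub_distrib, sum_const, nsmul_eq_mul, ← mul_sum,
      ← sum_mul, hc, lowerSum]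
    ring
  rw [h3, h2]
  linarith

/-- Two families in a layer of the cube that are far apart in the Johnson graph
are separated by a large family. -/
lemma card_mul_card_le_of_separated (M s : ℕ) (hM0 : M ≠ 0) (hM : M ≤ Fintype.card α)
    (P Q R : Finset (Finset α)) (hs : 2 ≤ s)
    (hP : P ⊆ powersetCard M univ) (hQ : Q ⊆ powersetCard M univ)
    (hcover : powersetCard M univ ⊆ P ∪ Q ∪ R)
    (hsep : ∀ S ∈ Q, ∀ F ∈ P, s ≤ #(S \ F)) :
    (s : ℝ) ^ 2 * (#P * #Q) ≤
      Fintype.card α * (Fintype.card α).choose M * #(R) := by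
  obtain rfl | hPne := P.eq_empty_or_nonempty
  · simp only [card_empty, Nat.cast_zero, zero_mul, mul_zero]; positivity
  obtain ⟨m, rfl⟩ := Nat.exists_eq_succ_of_ne_zero hM0
  set n := Fintype.card α with hn
  set L := powersetCard (m + 1) (univ : Finset α) with hL
  set d : Finset α → ℕ := fun S => P.inf' hPne fun F => #(S \ F) with hd
  set f : Finset α → ℝ := fun S => ((min s (d S) : ℕ) : ℝ) with hf
  have hfP : ∀ S ∈ P, f S = 0 := by
    intro S hS
    have : d S ≤ #(S \ S) := inf'_le _ hS
    simp only [sdiff_self, bot_eq_empty, card_empty, Nat.le_zero] at this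
    simp [hf, this]
  have hfQ : ∀ S ∈ Q, f S = s := by
    intro S hS
    have : s ≤ d S := le_inf' _ _ fun F hF => hsep S hS F hF
    simp [hf, this]
  have hmono : ∀ T a, d T ≤ d (insert a T) := fun T a =>
    le_inf' _ _ fun F hF => (inf'_le _ hF).trans
      (card_le_card (sdiff_subset_sdiff (subset_insert a T) le_rfl))
  have hstep : ∀ T a, d (insert a T) ≤ d T + 1 := by
    intro T a
    obtain ⟨F, hF, hFd⟩ := exists_mem_eq_inf' hPne fun F => #(T \ F)
    calc d (insert a T) ≤ #(insert a T \ F) := inf'_le _ hF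
      _ ≤ #(insert a (T \ F)) := card_le_card fun x hx => by
        simp only [mem_sdiff, mem_insert] at hx ⊢; tauto
      _ ≤ #(T \ F) + 1 := card_insert_le _ _
      _ = d T + 1 := by rw [hd]; simp only [hFd]
  have hlip : ∀ T a b, (f (insert a T) - f (insert b T)) ^ 2 ≤ 1 := by
    intro T a b
    rw [sq_le_one_iff_abs_le_one, abs_le]
    have h1 := hmono T a
    have h2 := hmono T b
    have h3 := hstep T a
    have h4 := hstep T b
    have h5 : min s (d (insert a T)) ≤ min s (d (insert b T)) + 1 := by omega
    have h6 : min s (d (insert b T)) ≤ min s (d (insert a T)) + 1 := by omega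
    have h5' : f (insert a T) ≤ f (insert b T) + 1 := by simp only [hf]; exact_mod_cast h5
    have h6' : f (insert b T) ≤ f (insert a T) + 1 := by simp only [hf]; exact_mod_cast h6
    constructor <;> linarith
  set g : Finset α → ℝ := fun S => if S ∈ R then 1 else 0 with hg
  have hg0 : ∀ S, 0 ≤ g S := fun S => by simp only [hg]; split_ifs <;> norm_num
  have hs' : (2 : ℝ) ≤ s := by exact_mod_cast hs
  have hedge : ∀ T a b, insert a T ∈ L → insert b T ∈ L →
      (f (insert a T) - f (insert b T)) ^ 2 ≤ g (insert a T) + g (insert b T) := by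
    intro T a b ha hb
    have hl := hlip T a b
    by_cases hRa : insert a T ∈ R
    · have : g (insert a T) = 1 := by simp [hg, hRa]
      linarith [hg0 (insert b T)]
    by_cases hRb : insert b T ∈ R
    · have : g (insert b T) = 1 := by simp [hg, hRb]
      linarith [hg0 (insert a T)]
    have ha' := hcover ha
    have hb' := hcover hb
    simp only [mem_union, hRa, hRb, or_false] at ha' hb'
    have hsum := add_nonneg (hg0 (insert a T)) (hg0 (insert b T))
    rcases ha' with ha' | ha' <;> rcases hb' with hb' | hb'
    · rw [hfP _ ha', hfP _ hb']; simpa using hsum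
    · rw [hfP _ ha', hfQ _ hb'] at hl; nlinarith
    · rw [hfQ _ ha', hfP _ hb'] at hl; nlinarith
    · rw [hfQ _ ha', hfQ _ hb']; simpa using hsum
  have hN : (#L : ℝ) = n.choose (m + 1) := by rw [hL, card_powersetCard, card_univ]
  have hNpos : (0 : ℝ) < n.choose (m + 1) := by exact_mod_cast Nat.choose_pos hM
  set t : ℝ := (∑ S ∈ L, f S) / n.choose (m + 1) with ht
  have hmean : ∑ S ∈ L, (f S - t) = 0 := by
    rw [sum_sub_distrib, sum_const, nsmul_eq_mul, hN, ht]
    field_simp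
    ring
  have hpoin := johnson_poincare m hM (fun S => f S - t) hmean
  have hmn : (m : ℝ) + 1 ≤ n := by exact_mod_cast hM
  have hupper : ∑ T ∈ powersetCard m (univ : Finset α), ∑ a ∈ Tᶜ, ∑ b ∈ Tᶜ,
      (f (insert a T) - t - (f (insert b T) - t)) ^ 2 ≤
      2 * ((n : ℝ) - m) * ((m + 1) * ∑ S ∈ L, g S) := by
    rw [← sum_lowerSum, mul_sum]
    refine sum_le_sum fun T hT => ?_
    have hTm := (mem_powersetCard.1 hT).2
    have hc : ((#Tᶜ : ℕ) : ℝ) = (n : ℝ) - m := by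
      rw [card_compl, Nat.cast_sub (card_le_univ T), hTm]
    have hmem : ∀ a ∈ Tᶜ, insert a T ∈ L := fun a ha => by
      rw [hL, mem_powersetCard, card_insert_of_notMem (mem_compl.1 ha), hTm]
      exact ⟨subset_univ _, rfl⟩
    calc _ ≤ ∑ a ∈ Tᶜ, ∑ b ∈ Tᶜ, (g (insert a T) + g (insert b T)) :=
          sum_le_sum fun a ha => sum_le_sum fun b hb => by
            rw [sub_sub_sub_cancel_right]
            exact hedge T a b (hmem a ha) (hmem b hb)
      _ = _ := by
        simp only [sum_add_distrib, sum_const, nsmul_eq_mul, ← mul_sum, hc, lowerSum]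
        ring
  have hgR : ∑ S ∈ L, g S ≤ #R := by
    simp only [hg, sum_boole]
    exact_mod_cast card_le_card fun S hS => (mem_filter.1 hS).2
  have hgsum : 0 ≤ ∑ S ∈ L, g S := sum_nonneg fun S _ => hg0 S
  have hvar : ∑ S ∈ L, (f S - t) ^ 2 ≤ n * #R := by
    have hn0 : (0 : ℝ) < n := by linarith [(Nat.cast_nonneg m : (0 : ℝ) ≤ m)]
    have : 2 * (n : ℝ) * ∑ S ∈ L, (f S - t) ^ 2 ≤ 2 * n * (n * #R) := by
      calc _ ≤ _ := hpoin
        _ ≤ _ := hupper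
        _ ≤ 2 * n * (n * #R) := by
          gcongr
          linarith [(Nat.cast_nonneg m : (0 : ℝ) ≤ m)]
    exact le_of_mul_le_mul_left this (by positivity)
  have hdisj : Disjoint P Q := by
    rw [disjoint_left]
    intro S hSP hSQ
    have := hsep S hSQ S hSP
    simp at this
    omega
  have hlower : #P * t ^ 2 + #Q * (s - t) ^ 2 ≤ ∑ S ∈ L, (f S - t) ^ 2 := by
    calc _ = ∑ S ∈ P ∪ Q, (f S - t) ^ 2 := by
          have h1 : ∑ S ∈ P, (f S - t) ^ 2 = ∑ S ∈ P, t ^ 2 :=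
            sum_congr rfl fun S hS => by rw [hfP S hS]; ring
          have h2 : ∑ S ∈ Q, (f S - t) ^ 2 = ∑ S ∈ Q, ((s : ℝ) - t) ^ 2 :=
            sum_congr rfl fun S hS => by rw [hfQ S hS]
          rw [sum_union hdisj, h1, h2]
          simp only [sum_const, nsmul_eq_mul]
      _ ≤ _ := sum_le_sum_of_subset_of_nonneg (union_subset hP hQ) fun _ _ _ => sq_nonneg _
  have hcard : (#P : ℝ) + #Q ≤ n.choose (m + 1) := by
    rw [← hN]
    exact_mod_cast (card_union_of_disjoint hdisj).symm.le.trans (card_le_card (union_subset hP hQ))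
  calc (s : ℝ) ^ 2 * ((#P : ℝ) * #Q) ≤ ((#P : ℝ) + #Q) * (#P * t ^ 2 + #Q * (s - t) ^ 2) := by
        nlinarith [sq_nonneg ((#P : ℝ) * t - #Q * (s - t))]
    _ ≤ (n.choose (m + 1) : ℝ) * ((n : ℝ) * #R) := by
        gcongr
        exact hlower.trans hvar
    _ = _ := by rw [Nat.succ_eq_add_one]; ring

/-- The upper shadow of a family occupies at least as large a proportion of its layer. -/
lemma card_div_choose_le_card_upShadow_iterate_div_choose (k r : ℕ)
    (h : k + r ≤ Fintype.card α) (𝒜 : Finset (Finset α)) (h𝒜 : 𝒜 ⊆ powersetCard k univ) :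
    (#𝒜 : ℝ) / (Fintype.card α).choose k ≤
      #(upShadow^[r] 𝒜) / (Fintype.card α).choose (k + r) := by
  induction r with
  | zero => simp
  | succ r ih =>
    refine (ih (by omega)).trans ?_
    rw [Function.iterate_succ_apply']
    have hsz : ((upShadow^[r] 𝒜 : Finset (Finset α)) : Set (Finset α)).Sized (k + r) := by
      intro S hS
      obtain ⟨T, hT, -, hc⟩ := mem_upShadow_iff_exists_mem_card_add.1 hS
      rw [← hc, (mem_powersetCard.1 (h𝒜 hT)).2]
    have h1 := local_lubell_yamamoto_meshalkin_inequality_div (𝕜 := ℝ)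
      (Nat.sub_ne_zero_of_lt (by omega)) hsz.compls
    rw [shadow_compls, card_compls, card_compls, Nat.choose_symm (by omega),
      Nat.sub_sub, Nat.choose_symm (by omega)] at h1
    exact h1

end Johnson

/-- The `r`-th upper shadows of a family in layer `k` and of its complement in that layer have
a large intersection, when `r` is at least `ε √n`. -/
lemma le_card_inter_upShadow_iterate (n k r : ℕ) (hr : 1 ≤ r) (hk : k + r ≤ n)
    (𝒜 : Finset (Finset (Fin n))) (h𝒜 : 𝒜 ⊆ powersetCard k univ) (ε a ρ : ℝ)
    (hε0 : 0 < ε) (hε1 : ε < 1) (hεr : ε ^ 2 * n ≤ (r : ℝ) ^ 2)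
    (ha : a = #𝒜 / n.choose k)
    (hρ : ρ = #(upShadow^[r] 𝒜 ∩ upShadow^[r] (powersetCard k univ \ 𝒜)) / n.choose (k + r)) :
    ε ^ 2 * (a * (1 - a)) / 4 ≤ ρ := by
  set ℬ := powersetCard k univ \ 𝒜 with hℬ
  have hℬs : ℬ ⊆ powersetCard k univ := sdiff_subset
  set L := powersetCard (k + r) (univ : Finset (Fin n)) with hL
  have hsub : ∀ 𝒞 ⊆ powersetCard k (univ : Finset (Fin n)), upShadow^[r] 𝒞 ⊆ L := by
    intro 𝒞 h𝒞 S hS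
    obtain ⟨T, hT, -, hc⟩ := mem_upShadow_iff_exists_mem_card_add.1 hS
    rw [hL, mem_powersetCard, ← hc, (mem_powersetCard.1 (h𝒞 hT)).2]
    exact ⟨subset_univ _, rfl⟩
  set P := L \ upShadow^[r] ℬ with hP
  set Q := L \ upShadow^[r] 𝒜 with hQ
  set R := upShadow^[r] 𝒜 ∩ upShadow^[r] ℬ with hR
  have hcover : L ⊆ P ∪ Q ∪ R := by
    intro S hS
    simp only [hP, hQ, hR, mem_union, mem_sdiff, mem_inter]
    tauto
  have hsep : ∀ S ∈ Q, ∀ F ∈ P, r + 1 ≤ #(S \ F) := by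
    intro S hS F hF
    rw [hQ, mem_sdiff, hL, mem_powersetCard] at hS
    rw [hP, mem_sdiff, hL, mem_powersetCard] at hF
    by_contra! hlt
    have hcard := card_sdiff_add_card_inter S F
    obtain ⟨T, hTs, hTk⟩ := exists_subset_card_eq (show k ≤ #(S ∩ F) by omega)
    by_cases hT : T ∈ 𝒜
    · exact hS.2 (mem_upShadow_iff_exists_mem_card_add.2
        ⟨T, hT, hTs.trans inter_subset_left, by omega⟩)
    · exact hF.2 (mem_upShadow_iff_exists_mem_card_add.2
        ⟨T, mem_sdiff.2 ⟨mem_powersetCard.2 ⟨subset_univ _, hTk⟩, hT⟩,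
          hTs.trans inter_subset_right, by omega⟩)
  have hmain := card_mul_card_le_of_separated (k + r) (r + 1) (by omega) (by simpa using hk)
    P Q R (by omega) sdiff_subset sdiff_subset hcover hsep
  rw [Fintype.card_fin] at hmain
  have hA := card_div_choose_le_card_upShadow_iterate_div_choose k r (by simpa using hk) 𝒜 h𝒜
  have hB := card_div_choose_le_card_upShadow_iterate_div_choose k r (by simpa using hk) ℬ hℬs
  rw [Fintype.card_fin] at hA hB
  have hN : (0 : ℝ) < n.choose (k + r) := by exact_mod_cast Nat.choose_pos hk
  have hNk : (0 : ℝ) < n.choose k := by exact_mod_cast Nat.choose_pos (by omega)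
  have hPA : (#(upShadow^[r] 𝒜) : ℝ) ≤ #P + #R := by
    exact_mod_cast (card_le_card fun S hS => by
      have := hsub 𝒜 h𝒜 hS
      simp only [hP, hR, mem_union, mem_sdiff, mem_inter]
      tauto : #(upShadow^[r] 𝒜) ≤ #(P ∪ R)).trans (card_union_le _ _)
  have hQB : (#(upShadow^[r] ℬ) : ℝ) ≤ #Q + #R := by
    exact_mod_cast (card_le_card fun S hS => by
      have := hsub ℬ hℬs hS
      simp only [hQ, hR, mem_union, mem_sdiff, mem_inter]
      tauto : #(upShadow^[r] ℬ) ≤ #(Q ∪ R)).trans (card_union_le _ _)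
  have hb : (#ℬ : ℝ) / n.choose k = 1 - a := by
    rw [hℬ, cast_card_sdiff h𝒜, card_powersetCard, card_univ, Fintype.card_fin, ha]
    field_simp
  set p : ℝ := #P / n.choose (k + r) with hp
  set q : ℝ := #Q / n.choose (k + r) with hq
  have hap : a - ρ ≤ p := by
    rw [sub_le_iff_le_add, ha, hp, hρ, ← add_div]
    exact hA.trans (by gcongr)
  have hbq : 1 - a - ρ ≤ q := by
    rw [sub_le_iff_le_add, ← hb, hq, hρ, ← add_div]
    exact hB.trans (by gcongr)
  have ha0 : 0 ≤ a := by rw [ha]; positivity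
  have hb0 : 0 ≤ 1 - a := by rw [← hb]; positivity
  have hρ0 : 0 ≤ ρ := by rw [hρ]; positivity
  have hn : (0 : ℝ) < n := by exact_mod_cast (by omega : 0 < n)
  have hpq : ε ^ 2 * (p * q) ≤ ρ := by
    have h1 : n * (ε ^ 2 * ((#P : ℝ) * #Q)) ≤ n * (n.choose (k + r) * #R) := by
      calc _ = (ε ^ 2 * n) * ((#P : ℝ) * #Q) := by ring
        _ ≤ ((r + 1 : ℕ) : ℝ) ^ 2 * (#P * #Q) := by
          gcongr
          refine hεr.trans ?_
          gcongr
          simp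
        _ ≤ _ := hmain
        _ = _ := by ring
    have h2 := le_of_mul_le_mul_left h1 hn
    rw [hp, hq, hρ, div_mul_div_comm, mul_div_assoc', div_le_div_iff₀ (by positivity) hN]
    nlinarith
  have hab : a * (1 - a) ≤ a ∧ a * (1 - a) ≤ 1 - a := ⟨by nlinarith, by nlinarith⟩
  have hab0 : 0 ≤ a * (1 - a) := mul_nonneg ha0 hb0
  have hε2 : ε ^ 2 ≤ 1 := by nlinarith
  by_cases hcase : a * (1 - a) / 4 ≤ ρ
  · linarith [mul_le_of_le_one_left hab0 hε2]
  · push Not at hcase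
    have h1 : 3 / 4 * a ≤ p := by linarith
    have h2 : 3 / 4 * (1 - a) ≤ q := by linarith
    have h3 : 3 / 4 * a * (3 / 4 * (1 - a)) ≤ p * q :=
      mul_le_mul h1 h2 (by positivity) (by linarith)
    have h4 := mul_le_mul_of_nonneg_left h3 (sq_nonneg ε)
    have h5 := mul_nonneg (sq_nonneg ε) hab0
    linarith

/-- Main theorem (Friedgut's conjecture, quantitative form): there are absolute constants
`C, c > 0` such that for all `ε ∈ (0,1)`, all even `n`, and all nonempty proper subfamilies
`𝒜` of `binom([n], n/2)`, if
`n ≥ (C/ε²)(log(1/ε) + log(1/(μ(𝒜)(1-μ(𝒜)))))`, then for `r = ⌈ε√n⌉`,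
`μ(∂^{+r}(𝒜) ∩ ∂^{+r}(𝒜ᶜ)) ≥ c·(ε²/log(1/(ε μ(𝒜)(1-μ(𝒜)))))·μ(𝒜)(1-μ(𝒜))`. -/
theorem friedgut_conjecture : ∃ C > (0 : ℝ), ∃ c > (0 : ℝ),
    ∀ (ε : ℝ), ε ∈ Set.Ioo (0 : ℝ) 1 → ∀ (n : ℕ), Even n →
    ∀ (𝒜 : Finset (Finset (Fin n))),
      𝒜 ⊆ Finset.powersetCard (n / 2) (Finset.univ : Finset (Fin n)) →
      𝒜 ≠ ∅ →
      𝒜 ≠ Finset.powersetCard (n / 2) (Finset.univ : Finset (Fin n)) →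
      ∀ μA : ℝ, μA = (𝒜.card : ℝ) / (n.choose (n / 2)) →
      (C / ε ^ 2) * (Real.log (1 / ε) + Real.log (1 / (μA * (1 - μA)))) ≤ (n : ℝ) →
      ∀ r : ℕ, r = ⌈ε * Real.sqrt n⌉₊ →
      c * (ε ^ 2 / Real.log (1 / (ε * μA * (1 - μA)))) * (μA * (1 - μA)) ≤
        (((Finset.upShadow^[r] 𝒜) ∩
          (Finset.upShadow^[r]
            (Finset.powersetCard (n / 2) (Finset.univ : Finset (Fin n)) \ 𝒜))).card : ℝ) /
          (n.choose (n / 2 + r)) := by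
  refine ⟨16, by norm_num, 1 / 4, by norm_num, ?_⟩
  intro ε hε n hn 𝒜 h𝒜 hne hne' μA hμ hbound r hr
  obtain ⟨hε0, hε1⟩ := hε
  have hNk : (0 : ℝ) < n.choose (n / 2) := by
    exact_mod_cast Nat.choose_pos (Nat.div_le_self n 2)
  have hμ0 : 0 < μA := by
    rw [hμ]
    have := card_pos.2 (nonempty_iff_ne_empty.2 hne)
    positivity
  have hμ1 : μA < 1 := by
    rw [hμ, div_lt_one hNk]
    have := card_lt_card (h𝒜.ssubset_of_ne hne')
    rw [card_powersetCard, card_univ, Fintype.card_fin] at this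
    exact_mod_cast this
  have hv0 : 0 < μA * (1 - μA) := mul_pos hμ0 (by linarith)
  have hv : μA * (1 - μA) ≤ 1 / 4 := by nlinarith [sq_nonneg (μA - 1 / 2)]
  have hlog4 : ∀ x : ℝ, 0 < x → x ≤ 1 / 4 → 1 ≤ Real.log (1 / x) := by
    intro x hx hx4
    rw [Real.le_log_iff_exp_le (by positivity)]
    have : 4 ≤ 1 / x := by rw [le_div_iff₀ hx]; linarith
    linarith [Real.exp_one_lt_d9]
  have hn16 : 16 ≤ ε ^ 2 * n := by
    have h1 : 0 ≤ Real.log (1 / ε) := Real.log_nonneg (by rw [le_div_iff₀ hε0]; linarith)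
    have h2 := hlog4 _ hv0 hv
    have h3 : 16 / ε ^ 2 * 1 ≤ n := le_trans (by gcongr; linarith) hbound
    rw [mul_one, div_le_iff₀ (by positivity)] at h3
    linarith
  have hεs : 4 ≤ ε * √n := by
    rw [← Real.sqrt_sq hε0.le, ← Real.sqrt_mul (sq_nonneg ε)]
    exact Real.le_sqrt_of_sq_le (by linarith)
  have hrge : ε * √n ≤ r := by rw [hr]; exact Nat.le_ceil _
  have hrlt : (r : ℝ) < ε * √n + 1 := by
    rw [hr]; exact Nat.ceil_lt_add_one (by positivity)
  have hsq : √(n : ℝ) ^ 2 = n := Real.sq_sqrt (Nat.cast_nonneg n)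
  have hr1 : 1 ≤ r := by
    have : (1 : ℝ) ≤ r := by linarith
    exact_mod_cast this
  have hs0 := Real.sqrt_nonneg (n : ℝ)
  have hkr : n / 2 + r ≤ n := by
    have h2 : (2 : ℝ) * r ≤ n := by nlinarith
    have h2' : 2 * r ≤ n := by exact_mod_cast h2
    omega
  have hεr : ε ^ 2 * n ≤ (r : ℝ) ^ 2 := by
    calc ε ^ 2 * n = (ε * √n) ^ 2 := by rw [mul_pow, hsq]
      _ ≤ _ := by gcongr
  have hmain := le_card_inter_upShadow_iterate n (n / 2) r hr1 hkr 𝒜 h𝒜 ε μA _ hε0 hε1 hεr hμ rfl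
  refine le_trans ?_ hmain
  have hlog : 1 ≤ Real.log (1 / (ε * μA * (1 - μA))) := by
    rw [mul_assoc]
    exact hlog4 _ (by positivity) (by nlinarith)
  have hdiv : ε ^ 2 / Real.log (1 / (ε * μA * (1 - μA))) ≤ ε ^ 2 :=
    div_le_self (by positivity) hlog
  nlinarith
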